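/- arXiv:2209.04067 — 8 statements merged into one kernel-verified Lean document; each statement's English description precedes it below -/
import Mathlib

section
/- Fix a finite-horizon MDP with transition functions p_t, a risk level α > 0, and a Markov randomized policy π = (π_t)_{t=0}^{T−1}. For t = 0,…,T and s ∈ S define v^π_t(s) = ERM^{α·γ^t}[ Σ_{t'=t}^{T−1} γ^{t'−t}·r(S_{t'}, A_{t'}) ], the entropic risk at level α·γ^t of the discounted tail return of the trajectory started at S_t = s (so v^π_T ≡ 0). Then for every t ∈ {0,…,T−1} and every s ∈ S, v^π_t(s) = -(1/(α·γ^t))·log( Σ_{a∈A} Σ_{s'∈S} π_t(a|s)·p_t(s'|s,a)·exp(−α·γ^t·(r(s,a) + γ·v^π_{t+1}(s'))) ); moreover (v^π_t)_{t=0}^{T} is the unique family of functions satisfying this system of equations together with the terminal condition v^π_T ≡ 0. -/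
open Finset

noncomputable section

/-- The state occupied at step `i` of a trajectory that starts in state `s`, where
`w j = (action taken at step j, state reached after step j)`. -/
def stAt {S A : Type*} {n : ℕ} (s : S) (w : Fin n → A × S) (i : Fin n) : S :=
  if _ : i.1 = 0 then s else (w ⟨i.1 - 1, Nat.lt_of_le_of_lt (Nat.sub_le i.1 1) i.2⟩).2

/-- Probability of the trajectory `w` (of length `n`) started at time `t` in state `s` under the
Markov randomized policy `π` and the transition probabilities `p`. -/
def trajProb {S A : Type*} [Fintype S] [Fintype A] (π : ℕ → S → A → ℝ) (p : ℕ → S → A → S → ℝ)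
    (t : ℕ) {n : ℕ} (s : S) (w : Fin n → A × S) : ℝ :=
  ∏ i : Fin n,
    π (t + i.1) (stAt s w i) (w i).1 * p (t + i.1) (stAt s w i) (w i).1 (w i).2

/-- The `γ`-discounted return `∑_i γ^i · r(S_i, A_i)` of the trajectory `w` started in `s`. -/
def trajRet {S A : Type*} (r : S → A → ℝ) (γ : ℝ) {n : ℕ} (s : S) (w : Fin n → A × S) : ℝ :=
  ∑ i : Fin n, γ ^ i.1 * r (stAt s w i) (w i).1

/-- `vPi π p r γ α T t s` is the value function
`v^π_t(s) = ERM^{α·γ^t}[ ∑_{t'=t}^{T-1} γ^{t'-t} r(S_{t'},A_{t'}) | S_t = s ]`, the entropic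
risk at level `α·γ^t` of the discounted tail return of the trajectory started at `S_t = s`. -/
def vPi {S A : Type*} [Fintype S] [Fintype A] (π : ℕ → S → A → ℝ) (p : ℕ → S → A → S → ℝ)
    (r : S → A → ℝ) (γ α : ℝ) (T t : ℕ) (s : S) : ℝ :=
  -(1 / (α * γ ^ t)) * Real.log
    (∑ w : Fin (T - t) → A × S,
      trajProb π p t s w * Real.exp (-(α * γ ^ t) * trajRet r γ s w))

lemma stAt_cons_zero {S A : Type*} {n : ℕ} (s : S) (x : A × S) (w : Fin n → A × S) :
    stAt s (Fin.cons x w : Fin (n + 1) → A × S) 0 = s := by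
  simp [stAt]

lemma stAt_cons_succ {S A : Type*} {n : ℕ} (s : S) (x : A × S) (w : Fin n → A × S) (i : Fin n) :
    stAt s (Fin.cons x w : Fin (n + 1) → A × S) i.succ = stAt x.2 w i := by
  obtain ⟨i, hi⟩ := i
  cases i with
  | zero => simp [stAt]
  | succ k =>
    have h : (⟨k + 1, by omega⟩ : Fin (n + 1)) = Fin.succ ⟨k, by omega⟩ := rfl
    simp only [stAt, Fin.val_succ, Nat.add_sub_cancel, h, Fin.cons_succ]
    simp

lemma trajProb_cons {S A : Type*} [Fintype S] [Fintype A] (π : ℕ → S → A → ℝ)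
    (p : ℕ → S → A → S → ℝ) (t : ℕ) {n : ℕ} (s : S) (x : A × S) (w : Fin n → A × S) :
    trajProb π p t s (Fin.cons x w : Fin (n + 1) → A × S) =
      π t s x.1 * p t s x.1 x.2 * trajProb π p (t + 1) x.2 w := by
  unfold trajProb
  rw [Fin.prod_univ_succ]
  simp only [stAt_cons_zero, stAt_cons_succ, Fin.cons_zero, Fin.cons_succ, Fin.val_succ,
    Fin.val_zero, Nat.add_zero]
  congr 1
  refine Finset.prod_congr rfl fun i _ => ?_
  rw [show t + (i.1 + 1) = t + 1 + i.1 by omega]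

lemma trajRet_cons {S A : Type*} (r : S → A → ℝ) (γ : ℝ) {n : ℕ} (s : S) (x : A × S)
    (w : Fin n → A × S) :
    trajRet r γ s (Fin.cons x w : Fin (n + 1) → A × S) = r s x.1 + γ * trajRet r γ x.2 w := by
  unfold trajRet
  rw [Fin.sum_univ_succ]
  simp only [stAt_cons_zero, stAt_cons_succ, Fin.cons_zero, Fin.cons_succ, Fin.val_succ,
    Fin.val_zero, pow_zero, one_mul]
  rw [Finset.mul_sum]
  congr 1
  refine Finset.sum_congr rfl fun i _ => ?_
  ring

/-- The moment generating sum. -/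
def mgfZ {S A : Type*} [Fintype S] [Fintype A] (π : ℕ → S → A → ℝ) (p : ℕ → S → A → S → ℝ)
    (r : S → A → ℝ) (γ c : ℝ) (t n : ℕ) (s : S) : ℝ :=
  ∑ w : Fin n → A × S, trajProb π p t s w * Real.exp (-c * trajRet r γ s w)

lemma mgfZ_succ {S A : Type*} [Fintype S] [Fintype A] (π : ℕ → S → A → ℝ)
    (p : ℕ → S → A → S → ℝ) (r : S → A → ℝ) (γ c : ℝ) (t n : ℕ) (s : S) :
    mgfZ π p r γ c t (n + 1) s = ∑ a : A, ∑ s' : S, π t s a * p t s a s' *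
      (Real.exp (-c * r s a) * mgfZ π p r γ (c * γ) (t + 1) n s') := by
  unfold mgfZ
  rw [← (Fin.consEquiv (fun _ : Fin (n + 1) => A × S)).sum_comp, Fintype.sum_prod_type,
    Fintype.sum_prod_type]
  refine Finset.sum_congr rfl fun a _ => Finset.sum_congr rfl fun s' _ => ?_
  rw [Finset.mul_sum, Finset.mul_sum]
  refine Finset.sum_congr rfl fun w _ => ?_
  simp only [Fin.consEquiv, Equiv.coe_fn_mk]
  rw [trajProb_cons, trajRet_cons,
    show -c * (r s a + γ * trajRet r γ s' w) = -c * r s a + -(c * γ) * trajRet r γ s' w by ring,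
    Real.exp_add]
  ring

lemma avg_pos {S A : Type*} [Fintype S] [Fintype A] (f : A → ℝ) (q : A → S → ℝ) (g : A → S → ℝ)
    (hf : ∀ a, 0 ≤ f a) (hf1 : ∑ a, f a = 1) (hq : ∀ a s, 0 ≤ q a s) (hq1 : ∀ a, ∑ s, q a s = 1)
    (hg : ∀ a s, 0 < g a s) : 0 < ∑ a, ∑ s, f a * q a s * g a s := by
  obtain ⟨a, -, ha⟩ := Finset.exists_lt_of_sum_lt (s := Finset.univ) (f := fun _ : A => (0 : ℝ))
    (g := f) (by simp [hf1])
  obtain ⟨s, -, hs⟩ := Finset.exists_lt_of_sum_lt (s := Finset.univ) (f := fun _ : S => (0 : ℝ))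
    (g := q a) (by simp [hq1])
  have h0 : ∀ a s, 0 ≤ f a * q a s * g a s := fun a s =>
    mul_nonneg (mul_nonneg (hf a) (hq a s)) (hg a s).le
  refine Finset.sum_pos' (fun a _ => Finset.sum_nonneg fun s _ => h0 a s) ⟨a, Finset.mem_univ _, ?_⟩
  exact Finset.sum_pos' (fun s _ => h0 a s)
    ⟨s, Finset.mem_univ _, mul_pos (mul_pos ha hs) (hg a s)⟩

lemma mgfZ_pos {S A : Type*} [Fintype S] [Fintype A] (π : ℕ → S → A → ℝ)
    (p : ℕ → S → A → S → ℝ) (r : S → A → ℝ) (γ : ℝ) (T : ℕ)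
    (hp : ∀ t < T, ∀ s a, (∀ s', 0 ≤ p t s a s') ∧ ∑ s', p t s a s' = 1)
    (hπ : ∀ t < T, ∀ s, (∀ a, 0 ≤ π t s a) ∧ ∑ a, π t s a = 1) (n : ℕ) :
    ∀ (c : ℝ) (t : ℕ) (s : S), t + n ≤ T → 0 < mgfZ π p r γ c t n s := by
  induction n with
  | zero =>
    intro c t s _
    simp [mgfZ, trajProb, trajRet]
  | succ n ih =>
    intro c t s h
    rw [mgfZ_succ]
    have ht : t < T := by omega
    exact avg_pos _ _ _ (hπ t ht s).1 (hπ t ht s).2 (fun a => (hp t ht s a).1)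
      (fun a => (hp t ht s a).2)
      fun a s' => mul_pos (Real.exp_pos _) (ih _ _ _ (by omega))

/-- **Bellman equations for RASR-ERM policy evaluation.**  In a finite-horizon MDP with
transitions `p_t`, rewards `r`, discount `γ ∈ (0,1]`, risk level `α > 0`, and a Markov
randomized policy `π`, the value functions `v^π_t` (entropic risk at level `α·γ^t` of the
discounted tail return from time `t`, with `v^π_T ≡ 0`) satisfy, for every `t < T` and `s`,
`v^π_t(s) = -(1/(αγ^t)) log ( ∑_a ∑_{s'} π_t(a|s) p_t(s'|s,a) exp(-αγ^t (r(s,a) + γ v^π_{t+1}(s'))) )`,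
and `(v^π_t)_{t≤T}` is the unique family satisfying this system together with the terminal
condition `v^π_T ≡ 0`. -/
theorem rasr_erm_policy_bellman {S A : Type*} [Fintype S] [Fintype A] [Nonempty S] [Nonempty A]
    (r : S → A → ℝ) (T : ℕ) (γ : ℝ) (hγ0 : 0 < γ) (hγ1 : γ ≤ 1)
    (p : ℕ → S → A → S → ℝ)
    (hp : ∀ t < T, ∀ s a, (∀ s', 0 ≤ p t s a s') ∧ ∑ s', p t s a s' = 1)
    (α : ℝ) (hα : 0 < α)
    (π : ℕ → S → A → ℝ)
    (hπ : ∀ t < T, ∀ s, (∀ a, 0 ≤ π t s a) ∧ ∑ a, π t s a = 1) :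
    (∀ t < T, ∀ s : S,
      vPi π p r γ α T t s =
        -(1 / (α * γ ^ t)) * Real.log (∑ a : A, ∑ s' : S,
          π t s a * p t s a s' *
            Real.exp (-(α * γ ^ t) * (r s a + γ * vPi π p r γ α T (t + 1) s')))) ∧
    (∀ v : ℕ → S → ℝ,
      (∀ s, v T s = 0) →
      (∀ t < T, ∀ s : S,
        v t s =
          -(1 / (α * γ ^ t)) * Real.log (∑ a : A, ∑ s' : S,
            π t s a * p t s a s' *
              Real.exp (-(α * γ ^ t) * (r s a + γ * v (t + 1) s')))) →
      ∀ t ≤ T, ∀ s : S, v t s = vPi π p r γ α T t s) := by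
  have key : ∀ t < T, ∀ s : S,
      vPi π p r γ α T t s =
        -(1 / (α * γ ^ t)) * Real.log (∑ a : A, ∑ s' : S,
          π t s a * p t s a s' *
            Real.exp (-(α * γ ^ t) * (r s a + γ * vPi π p r γ α T (t + 1) s'))) := by
    intro t ht s
    have e1 : ∀ t s, vPi π p r γ α T t s =
      -(1 / (α * γ ^ t)) * Real.log (mgfZ π p r γ (α * γ ^ t) t (T - t) s) := fun _ _ => rfl
    rw [e1 t s]
    congr 2
    obtain ⟨n, hn⟩ : ∃ n, T - t = n + 1 := ⟨T - t - 1, by omega⟩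
    have hn' : T - (t + 1) = n := by omega
    rw [hn, mgfZ_succ]
    refine Finset.sum_congr rfl fun a _ => Finset.sum_congr rfl fun s' _ => ?_
    congr 1
    have hpos := mgfZ_pos π p r γ T hp hπ n (α * γ ^ (t + 1)) (t + 1) s' (by omega)
    rw [e1, hn', mul_add, Real.exp_add, mul_assoc α, ← pow_succ]
    congr 1
    have hc : α * γ ^ (t + 1) ≠ 0 := by positivity
    have : -(α * γ ^ t) * (γ * (-(1 / (α * γ ^ (t + 1))) *
        Real.log (mgfZ π p r γ (α * γ ^ (t + 1)) (t + 1) n s'))) =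
        Real.log (mgfZ π p r γ (α * γ ^ (t + 1)) (t + 1) n s') := by
      field_simp
      rw [pow_succ]
    rw [this, Real.exp_log hpos]
  refine ⟨key, fun v hT hv => ?_⟩
  have main : ∀ k t, t + k = T → ∀ s : S, v t s = vPi π p r γ α T t s := by
    intro k
    induction k with
    | zero =>
      intro t h s
      obtain rfl : t = T := by omega
      rw [hT]
      unfold vPi
      rw [Nat.sub_self]
      simp [trajProb, trajRet]
    | succ k ih =>
      intro t h s
      rw [hv t (by omega) s, key t (by omega) s]
      simp only [ih (t + 1) (by omega)]
  intro t ht s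
  exact main (T - t) t (by omega) s


end
end

section
/- Let Π be a nonempty finite set, let (X_π)_{π∈Π} be bounded real-valued random variables, and let β ∈ (0,1). Suppose π* ∈ Π maximizes EVaR^β[X_π] over π ∈ Π, and suppose the supremum defining EVaR^β[X_{π*}] is attained at some α* > 0, i.e., EVaR^β[X_{π*}] = ERM^{α*}[X_{π*}] + log(1−β)/α*. Then for every π ∈ Π, ERM^{α*}[X_{π*}] ≥ ERM^{α*}[X_π]; that is, any EVaR-optimal element is also ERM-optimal at the risk level α*. -/
open MeasureTheory

/-- The entropic risk measure at level `α`: `ERM^α[X] = -(1/α) log E[exp(-α X)]`. -/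
noncomputable def erm {Ω : Type*} [MeasurableSpace Ω] (μ : Measure Ω) (α : ℝ) (X : Ω → ℝ) : ℝ :=
  -(1 / α) * Real.log (∫ ω, Real.exp (-α * X ω) ∂μ)

/-- The entropic value-at-risk at confidence level `β`:
`EVaR^β[X] = sup_{α>0} (ERM^α[X] + log(1−β)/α)`. -/
noncomputable def evar {Ω : Type*} [MeasurableSpace Ω] (μ : Measure Ω) (β : ℝ) (X : Ω → ℝ) : ℝ :=
  sSup {y | ∃ α > (0 : ℝ), y = erm μ α X + Real.log (1 - β) / α}

/-- **Any EVaR-optimal element is ERM-optimal at the attaining risk level.**  Let `ι` be a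
nonempty finite index set, `(X i)` bounded random variables, `β ∈ (0,1)`.  If `istar`
maximizes `EVaR^β[X i]` over `i ∈ ι` and the supremum defining `EVaR^β[X istar]` is attained at
some `αstar > 0`, then `ERM^{αstar}[X istar] ≥ ERM^{αstar}[X i]` for every `i`. -/
theorem evar_optimal_is_erm_optimal {Ω : Type*} [MeasurableSpace Ω] (μ : Measure Ω)
    [IsProbabilityMeasure μ] {ι : Type*} [Fintype ι] [Nonempty ι]
    (X : ι → Ω → ℝ) (hXm : ∀ i, Measurable (X i)) (hXb : ∀ i, ∃ C, ∀ ω, |X i ω| ≤ C)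
    (β : ℝ) (hβ : β ∈ Set.Ioo (0 : ℝ) 1)
    (istar : ι) (hopt : ∀ i, evar μ β (X i) ≤ evar μ β (X istar))
    (αstar : ℝ) (hαstar : 0 < αstar)
    (hatt : evar μ β (X istar) = erm μ αstar (X istar) + Real.log (1 - β) / αstar) :
    ∀ i, erm μ αstar (X i) ≤ erm μ αstar (X istar) := by
  intro i
  have hbdd : BddAbove {y | ∃ α > (0 : ℝ), y = erm μ α (X i) + Real.log (1 - β) / α} := by
    obtain ⟨C, hC⟩ := hXb i
    refine ⟨C, ?_⟩
    rintro y ⟨α, hα, rfl⟩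
    have hint : Integrable (fun ω => Real.exp (-α * X i ω)) μ := by
      refine Integrable.of_bound (C := Real.exp (α * C)) ?_ ?_
      · exact (Real.measurable_exp.comp ((hXm i).const_mul (-α))).aestronglyMeasurable
      · refine Filter.Eventually.of_forall fun ω => ?_
        rw [Real.norm_eq_abs, Real.abs_exp]
        apply Real.exp_le_exp.mpr
        nlinarith [(abs_le.mp (hC ω)).1]
    have h1 : Real.exp (-α * C) ≤ ∫ ω, Real.exp (-α * X i ω) ∂μ := by
      have := integral_mono (μ := μ) (integrable_const (Real.exp (-α * C))) hint (fun ω => by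
        apply Real.exp_le_exp.mpr
        nlinarith [(abs_le.mp (hC ω)).2])
      simpa using this
    have h2 : -α * C ≤ Real.log (∫ ω, Real.exp (-α * X i ω) ∂μ) :=
      (Real.le_log_iff_exp_le (lt_of_lt_of_le (Real.exp_pos _) h1)).mpr h1
    have h3 : Real.log (1 - β) / α ≤ 0 :=
      div_nonpos_of_nonpos_of_nonneg
        (Real.log_nonpos (by linarith [hβ.2]) (by linarith [hβ.1])) hα.le
    have h4 : erm μ α (X i) ≤ C := by
      unfold erm
      rw [neg_mul, one_div, inv_mul_eq_div, ← neg_div, div_le_iff₀ hα]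
      linarith
    linarith
  have h := le_csSup hbdd ⟨αstar, hαstar, rfl⟩
  have h' := hopt i
  rw [hatt] at h'
  unfold evar at h'
  linarith
end

section
/- Let β ∈ (0,1) and let X be a real-valued random variable with x_min ≤ X ≤ x_max almost surely and M = x_max − x_min > 0. If α* > 0 attains the supremum sup_{α>0} ( ERM^α[X] + log(1−β)/α ) (i.e., attains EVaR^β[X]), then α* ≥ sqrt( −8·log(1−β) ) / M. -/
open MeasureTheory

lemma tilted_hoeffding_bound {Ω : Type*} [MeasurableSpace Ω] (μ : Measure Ω)
    [IsProbabilityMeasure μ] (X : Ω → ℝ) (hX : Measurable X) (a b : ℝ)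
    (hb : ∀ᵐ ω ∂μ, X ω ∈ Set.Icc a b) (α : ℝ) :
    ∃ m : ℝ, ∀ s : ℝ,
      Real.log (∫ ω, Real.exp (-(α + s) * X ω) ∂μ) - Real.log (∫ ω, Real.exp (-α * X ω) ∂μ)
        ≤ -s * m + s ^ 2 * (b - a) ^ 2 / 8 := by
  have hint : ∀ t : ℝ, Integrable (fun ω => Real.exp (t * X ω)) μ := fun t =>
    ProbabilityTheory.integrable_exp_mul_of_mem_Icc hX.aemeasurable hb
  have hpos : ∀ t : ℝ, 0 < ∫ ω, Real.exp (t * X ω) ∂μ := fun t => integral_exp_pos (hint t)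
  have hprob : IsProbabilityMeasure (μ.tilted (fun ω => -α * X ω)) :=
    isProbabilityMeasure_tilted (hint (-α))
  have hb' : ∀ᵐ ω ∂(μ.tilted (fun ω => -α * X ω)), X ω ∈ Set.Icc a b :=
    (tilted_absolutelyContinuous μ _).ae_le hb
  have hH := ProbabilityTheory.hasSubgaussianMGF_of_mem_Icc
    (μ := μ.tilted (fun ω => -α * X ω)) hX.aemeasurable hb'
  set m := ∫ ω, X ω ∂(μ.tilted (fun ω => -α * X ω)) with hm
  refine ⟨m, fun s => ?_⟩
  have h := hH.mgf_le (-s)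
  unfold ProbabilityTheory.mgf at h
  rw [integral_exp_tilted] at h
  have e : ∫ ω, Real.exp (((fun ω => -α * X ω) + fun ω => -s * (X ω - m)) ω) ∂μ
      = Real.exp (s * m) * ∫ ω, Real.exp (-(α + s) * X ω) ∂μ := by
    rw [← integral_const_mul]
    congr 1
    ext ω
    rw [← Real.exp_add]
    congr 1
    simp only [Pi.add_apply]
    ring
  rw [e] at h
  have h2 := Real.log_le_log (div_pos (mul_pos (Real.exp_pos _) (hpos _)) (hpos _)) h
  rw [Real.log_exp, Real.log_div (mul_pos (Real.exp_pos _) (hpos _)).ne' (hpos _).ne',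
    Real.log_mul (Real.exp_pos _).ne' (hpos _).ne', Real.log_exp] at h2
  have h3 : (((‖b - a‖₊ / 2) ^ 2 : NNReal) : ℝ) = (b - a) ^ 2 / 4 := by
    push_cast
    rw [div_pow, Real.norm_eq_abs, sq_abs]
    norm_num
  rw [h3] at h2
  linarith

/-- **Lower bound on the risk level attaining EVaR.**  Let `β ∈ (0,1)` and let `X` be a random
variable with `x_min ≤ X ≤ x_max` almost surely and `M = x_max − x_min > 0`.  If `αstar > 0`
attains the supremum `sup_{α>0} (ERM^α[X] + log(1−β)/α)` defining `EVaR^β[X]`, then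
`αstar ≥ sqrt(−8·log(1−β)) / M`. -/
theorem evar_attaining_alpha_lower_bound {Ω : Type*} [MeasurableSpace Ω] (μ : Measure Ω)
    [IsProbabilityMeasure μ] (X : Ω → ℝ) (hX : Measurable X) (xmin xmax : ℝ)
    (hlo : ∀ᵐ ω ∂μ, xmin ≤ X ω) (hhi : ∀ᵐ ω ∂μ, X ω ≤ xmax)
    (M : ℝ) (hM : M = xmax - xmin) (hMpos : 0 < M)
    (β : ℝ) (hβ : β ∈ Set.Ioo (0 : ℝ) 1)
    (αstar : ℝ) (hαstar : 0 < αstar)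
    (hatt : ∀ α > (0 : ℝ),
      erm μ α X + Real.log (1 - β) / α ≤ erm μ αstar X + Real.log (1 - β) / αstar) :
    Real.sqrt (-8 * Real.log (1 - β)) / M ≤ αstar := by
  have hb : ∀ᵐ ω ∂μ, X ω ∈ Set.Icc xmin xmax := by
    filter_upwards [hlo, hhi] with ω h1 h2 using ⟨h1, h2⟩
  obtain ⟨m, hm⟩ := tilted_hoeffding_bound μ X hX xmin xmax hb αstar
  rw [← hM] at hm
  unfold erm at hatt
  set L := Real.log (1 - β) with hL
  set K : ℝ → ℝ := fun α => Real.log (∫ ω, Real.exp (-α * X ω) ∂μ) with hK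
  have hm' : ∀ s, K (αstar + s) - K αstar ≤ -s * m + s ^ 2 * M ^ 2 / 8 := hm
  have hatt' : ∀ α > 0, -(1 / α) * K α + L / α ≤ -(1 / αstar) * K αstar + L / αstar := hatt
  have hK0 : K 0 = 0 := by simp [hK]
  have h0 := hm' (-αstar)
  rw [add_neg_cancel, hK0] at h0
  -- the slope `c` at the optimum
  obtain ⟨c, hc⟩ : ∃ c, c = (K αstar - L) / αstar := ⟨_, rfl⟩
  have hcα : c * αstar = K αstar - L := by rw [hc]; field_simp
  have hcm : c ≤ -m := by
    refine le_of_forall_pos_le_add fun ε hε => ?_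
    obtain ⟨s, hs⟩ : ∃ s, s = 8 * ε / M ^ 2 := ⟨_, rfl⟩
    have hspos : 0 < s := by rw [hs]; positivity
    have hsM : s * M ^ 2 = 8 * ε := by rw [hs]; field_simp
    have h1 := hatt' (αstar + s) (by linarith)
    have h2 : c ≤ (K (αstar + s) - L) / (αstar + s) := by
      have e1 : -(1 / αstar) * K αstar + L / αstar = -c := by rw [hc]; ring
      have e2 : -(1 / (αstar + s)) * K (αstar + s) + L / (αstar + s)
          = -((K (αstar + s) - L) / (αstar + s)) := by ring
      linarith
    rw [le_div_iff₀ (by linarith)] at h2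
    have h3 := hm' s
    have h4 : s * c ≤ s * (-m + ε) := by
      have : s ^ 2 * M ^ 2 / 8 = s * ε := by
        rw [pow_two, mul_assoc, hsM]; ring
      linarith
    exact le_of_mul_le_mul_left h4 hspos
  have h5 : c * αstar ≤ -m * αstar := mul_le_mul_of_nonneg_right hcm hαstar.le
  rw [div_le_iff₀ hMpos]
  apply Real.sqrt_le_iff.mpr
  refine ⟨by positivity, ?_⟩
  rw [mul_pow]
  linarith
end

section
/- Let β = 1/2 and let X be the finitely supported real random variable taking the value −2 with probability 1/50 and the value 1 with probability 49/50, so that ERM^α[X] = -(1/α)·log( (1/50)·exp(2α) + (49/50)·exp(−α) ). Define h : (0,∞) → ℝ by h(α) = max(0, ERM^α[X]) + log(1/2)/α (the maximum over the two policies' objective values, the first policy having constant return 0). Then h is neither convex nor concave on (0,∞), and the map ζ ↦ h(1/ζ) is also neither convex nor concave on (0,∞). -/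
/-- The EVaR objective `h(α) = max_π (ERM^α[X_π] + log(1/2)/α)` of the paper's two-policy
counterexample: one policy has constant return `0`, the other's return takes value `−2` with
probability `1/50` and value `1` with probability `49/50`, so that
`ERM^α[X] = -(1/α)·log((1/50)·exp(2α) + (49/50)·exp(−α))`. -/
noncomputable def hCounter (α : ℝ) : ℝ :=
  max 0 (-(1 / α) * Real.log ((1 / 50) * Real.exp (2 * α) + (49 / 50) * Real.exp (-α))) +
    Real.log (1 / 2) / α

lemma hCounter_large (a : ℝ) (ha : 2 ≤ a) : hCounter a = -Real.log 2 / a := by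
  have h1 : (50 : ℝ) ≤ Real.exp (2 * a) := by
    have h4 : Real.exp 4 ≤ Real.exp (2 * a) := Real.exp_le_exp.mpr (by linarith)
    have h5 : Real.exp 4 = Real.exp 1 ^ 4 := by rw [← Real.exp_nat_mul]; norm_num
    have h6 : (2.7 : ℝ) ^ 4 ≤ Real.exp 1 ^ 4 :=
      pow_le_pow_left₀ (by norm_num) (by linarith [Real.exp_one_gt_d9]) 4
    norm_num at h6
    linarith
  have h2 : 0 ≤ Real.log ((1 / 50) * Real.exp (2 * a) + (49 / 50) * Real.exp (-a)) := by
    apply Real.log_nonneg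
    linarith [Real.exp_pos (-a)]
  have h3 : 0 ≤ 1 / a := by positivity
  unfold hCounter
  rw [max_eq_left (by nlinarith [mul_nonneg h3 h2]), one_div, Real.log_inv]
  ring

lemma hCounter_one : 2 / 5 - Real.log 2 ≤ hCounter 1 := by
  have h0 := Real.exp_one_lt_d9
  have h0' := Real.exp_one_gt_d9
  have h1 : Real.exp (2 * 1) < 7.4 := by
    have : Real.exp (2 * 1) = Real.exp 1 * Real.exp 1 := by rw [← Real.exp_add]; norm_num
    rw [this]; nlinarith
  have h2 : Real.exp (-1) < 0.4 := by
    have : Real.exp (-1) * Real.exp 1 = 1 := by rw [← Real.exp_add]; norm_num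
    nlinarith [Real.exp_pos (-1)]
  have h3 := Real.log_le_sub_one_of_pos
    (x := (1 / 50) * Real.exp (2 * 1) + (49 / 50) * Real.exp (-1)) (by positivity)
  have h4 := le_max_right 0
    (-(1 / 1) * Real.log ((1 / 50) * Real.exp (2 * 1) + (49 / 50) * Real.exp (-1)))
  unfold hCounter
  rw [one_div 2, Real.log_inv]
  norm_num at *
  linarith

lemma hCounter_half : hCounter (1 / 2) ≤ 1 - 2 * Real.log 2 := by
  have h1 : -(1 / 2 : ℝ) ≤ Real.log ((1 / 50) * Real.exp (2 * (1 / 2))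
      + (49 / 50) * Real.exp (-(1 / 2))) := by
    rw [Real.le_log_iff_exp_le (by positivity)]
    have : Real.exp (-(1 / 2)) ≤ Real.exp (2 * (1 / 2)) := Real.exp_le_exp.mpr (by norm_num)
    linarith
  have h2 : max 0 (-(1 / (1 / 2)) * Real.log ((1 / 50) * Real.exp (2 * (1 / 2))
      + (49 / 50) * Real.exp (-(1 / 2)))) ≤ 1 := by
    apply max_le (by norm_num)
    rw [one_div_one_div]
    linarith
  have h3 : Real.log (1 / 2) / (1 / 2) = -2 * Real.log 2 := by
    rw [one_div 2, Real.log_inv]; ring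
  unfold hCounter
  rw [h3]
  linarith

/-- **The EVaR objective is in general neither convex nor concave, in `α` or in `α⁻¹`.**
For `β = 1/2` and the two-policy counterexample above, `h` is neither convex nor concave on
`(0, ∞)`, and `ζ ↦ h(1/ζ)` is also neither convex nor concave on `(0, ∞)`. -/
theorem hCounter_not_convex_not_concave :
    ¬ ConvexOn ℝ (Set.Ioi (0 : ℝ)) hCounter ∧
    ¬ ConcaveOn ℝ (Set.Ioi (0 : ℝ)) hCounter ∧
    ¬ ConvexOn ℝ (Set.Ioi (0 : ℝ)) (fun ζ => hCounter (1 / ζ)) ∧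
    ¬ ConcaveOn ℝ (Set.Ioi (0 : ℝ)) (fun ζ => hCounter (1 / ζ)) := by
  have l0 := Real.log_two_gt_d9
  have l1 := Real.log_two_lt_d9
  have e1 := hCounter_one
  have eh := hCounter_half
  have e2 := hCounter_large 2 (by norm_num)
  have e3 := hCounter_large 3 (by norm_num)
  have e4 := hCounter_large 4 (by norm_num)
  refine ⟨fun ⟨_, h⟩ => ?_, fun ⟨_, h⟩ => ?_, fun ⟨_, h⟩ => ?_, fun ⟨_, h⟩ => ?_⟩
  · have := @h (2) (by simp) (4) (by simp) (1 / 2) (1 / 2)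
      (by norm_num) (by norm_num) (by norm_num)
    simp only [smul_eq_mul] at this
    rw [show (1 / 2 * 2 + 1 / 2 * 4 : ℝ) = 3 by norm_num] at this
    linarith
  · have := @h (1) (by simp) (3) (by simp) (1 / 2) (1 / 2)
      (by norm_num) (by norm_num) (by norm_num)
    simp only [smul_eq_mul] at this
    rw [show (1 / 2 * 1 + 1 / 2 * 3 : ℝ) = 2 by norm_num] at this
    linarith
  · have := @h (1 / 2) (by simp) (2) (by simp) (2 / 3) (1 / 3)
      (by norm_num) (by norm_num) (by norm_num)
    simp only [smul_eq_mul] at this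
    rw [show (1 / (2 / 3 * (1 / 2) + 1 / 3 * 2) : ℝ) = 1 by norm_num, one_div_one_div] at this
    linarith
  · have := @h (1 / 4) (by simp) (1) (by simp) (2 / 3) (1 / 3)
      (by norm_num) (by norm_num) (by norm_num)
    simp only [smul_eq_mul] at this
    rw [show (1 / (2 / 3 * (1 / 4) + 1 / 3 * 1) : ℝ) = 2 by norm_num, one_div_one_div,
      one_div_one] at this
    linarith
end

section
/- Let A be a nonempty finite set, let d ∈ Δ(A) be a probability mass function, let g : A → ℝ, and let α > 0. Then -(1/α)·log( Σ_{a∈A} d(a)·exp(−α·g(a)) ) = min over probability mass functions d̄ ∈ Δ(A) that are absolutely continuous with respect to d (i.e., d(a) = 0 implies d̄(a) = 0) of [ Σ_{a∈A} d̄(a)·g(a) + (1/α)·Σ_{a∈A} d̄(a)·log( d̄(a)/d(a) ) ], where terms with d̄(a) = 0 are interpreted as 0, and the minimum is attained. -/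
open Finset

/-- **Donsker–Varadhan dual representation of the entropic risk measure.**  For a nonempty
finite set `A`, a pmf `d ∈ Δ(A)`, `g : A → ℝ`, and `α > 0`,
`-(1/α)·log(∑_a d(a)·exp(−α·g(a)))` is the least value of
`∑_a e(a)·g(a) + (1/α)·KL(e ‖ d)` over all pmfs `e ∈ Δ(A)` absolutely continuous with respect
to `d`, and the minimum is attained.  (Terms of the KL divergence with `e a = 0` vanish, which
is automatic here since `Real.log 0 = 0` and `0 * x = 0`.) -/
theorem erm_dual_representation {A : Type*} [Fintype A] [Nonempty A] (d : A → ℝ)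
    (hd0 : ∀ a, 0 ≤ d a) (hd1 : ∑ a, d a = 1) (g : A → ℝ) (α : ℝ) (hα : 0 < α) :
    IsLeast
      {y | ∃ e : A → ℝ, (∀ a, 0 ≤ e a) ∧ (∑ a, e a = 1) ∧ (∀ a, d a = 0 → e a = 0) ∧
        y = ∑ a, e a * g a + (1 / α) * ∑ a, e a * Real.log (e a / d a)}
      (-(1 / α) * Real.log (∑ a, d a * Real.exp (-α * g a))) := by
  have hZ : 0 < ∑ a, d a * Real.exp (-α * g a) := by
    have hnn : ∀ a ∈ Finset.univ, 0 ≤ d a * Real.exp (-α * g a) :=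
      fun a _ => mul_nonneg (hd0 a) (Real.exp_pos _).le
    refine lt_of_le_of_ne (Finset.sum_nonneg hnn) fun h => ?_
    have h0 := (Finset.sum_eq_zero_iff_of_nonneg hnn).1 h.symm
    have h1 : ∑ a, d a = 0 := Finset.sum_eq_zero fun a ha =>
      (mul_eq_zero.1 (h0 a ha)).resolve_right (Real.exp_pos _).ne'
    linarith
  set Z := ∑ a, d a * Real.exp (-α * g a) with hZdef
  have hsum : ∑ a, d a * Real.exp (-α * g a) / Z = 1 := by
    rw [← Finset.sum_div, ← hZdef, div_self hZ.ne']
  constructor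
  · refine ⟨fun a => d a * Real.exp (-α * g a) / Z, fun a => ?_, hsum, fun a h => ?_, ?_⟩
    · exact div_nonneg (mul_nonneg (hd0 a) (Real.exp_pos _).le) hZ.le
    · simp [h]
    · have hterm : ∀ a, d a * Real.exp (-α * g a) / Z *
          Real.log (d a * Real.exp (-α * g a) / Z / d a) =
          -α * (d a * Real.exp (-α * g a) / Z * g a)
            - Real.log Z * (d a * Real.exp (-α * g a) / Z) := by
        intro a
        by_cases h : d a = 0
        · simp [h]
        · have : d a * Real.exp (-α * g a) / Z / d a = Real.exp (-α * g a) / Z := by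
            field_simp
          rw [this, Real.log_div (Real.exp_pos _).ne' hZ.ne', Real.log_exp]
          ring
      simp only [hterm]
      rw [Finset.sum_sub_distrib, ← Finset.mul_sum, ← Finset.mul_sum, hsum]
      field_simp
      ring
  · rintro y ⟨e, he0, he1, hac, rfl⟩
    have hterm : ∀ a, -α * (e a * g a) - Real.log Z * e a + e a
        - d a * Real.exp (-α * g a) / Z ≤ e a * Real.log (e a / d a) := by
      intro a
      rcases (he0 a).eq_or_lt with h | h
      · rw [← h]
        have := div_nonneg (mul_nonneg (hd0 a) (Real.exp_pos (-α * g a)).le) hZ.le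
        simp only [zero_mul, mul_zero]
        linarith
      · have hd : d a ≠ 0 := fun h' => h.ne' (hac a h')
        have hdp : 0 < d a := lt_of_le_of_ne (hd0 a) hd.symm
        have hE := Real.exp_pos (-α * g a)
        have hx : 0 < d a * Real.exp (-α * g a) / Z / e a := by positivity
        have hl := Real.log_le_sub_one_of_pos hx
        rw [Real.log_div (by positivity) h.ne', Real.log_div (by positivity) hZ.ne',
          Real.log_mul hd hE.ne', Real.log_exp] at hl
        have hm := mul_le_mul_of_nonneg_left hl h.le
        have hc : e a * (d a * Real.exp (-α * g a) / Z / e a - 1)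
            = d a * Real.exp (-α * g a) / Z - e a := by
          field_simp
        rw [hc] at hm
        rw [Real.log_div h.ne' hd]
        linarith
    have hs := Finset.sum_le_sum fun a (_ : a ∈ Finset.univ) => hterm a
    rw [Finset.sum_sub_distrib, Finset.sum_add_distrib, Finset.sum_sub_distrib,
      ← Finset.mul_sum, ← Finset.mul_sum, hsum, he1] at hs
    have hm := mul_le_mul_of_nonneg_left hs (one_div_pos.2 hα).le
    have hc : 1 / α * (-α * ∑ a, e a * g a - Real.log Z * 1 + 1 - 1)
        = - ∑ a, e a * g a + -(1 / α) * Real.log Z := by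
      field_simp
      ring
    rw [hc] at hm
    linarith
end

section
/- Let X be a real-valued random variable on a probability space with x_min ≤ X ≤ x_max almost surely. Then for all risk levels 0 < α₁ ≤ α₂: 0 ≤ ERM^{α₁}[X] − ERM^{α₂}[X] ≤ (α₂ − α₁)·(x_max − x_min)²/8; in particular, α ↦ ERM^α[X] is nonincreasing on (0,∞) and Lipschitz with constant (x_max − x_min)²/8. -/
open MeasureTheory

open ProbabilityTheory in
theorem erm_aux_slope (g g1 g2 : ℝ → ℝ) (h1 : ∀ t, HasDerivAt g (g1 t) t)
    (h2 : ∀ t, HasDerivAt g1 (g2 t) t) (hn : ∀ t, 0 ≤ g2 t) (h0 : g 0 = 0)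
    (a b : ℝ) (ha : 0 < a) (hab : a ≤ b) : g a / a ≤ g b / b := by
  have hb : 0 < b := ha.trans_le hab
  have e1 : deriv g = g1 := funext fun t => (h1 t).deriv
  have e2 : deriv g1 = g2 := funext fun t => (h2 t).deriv
  have hc : ConvexOn ℝ Set.univ g := by
    apply convexOn_univ_of_deriv2_nonneg
    · exact fun t => (h1 t).differentiableAt
    · rw [e1]; exact fun t => (h2 t).differentiableAt
    · intro t
      simp only [Function.iterate_succ, Function.iterate_zero, Function.comp, id, e1, e2]
      exact hn t
  have hle : a / b ≤ 1 := (div_le_one hb).2 hab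
  have := hc.2 (Set.mem_univ b) (Set.mem_univ 0) (div_pos ha hb).le (sub_nonneg.2 hle)
    (by ring)
  simp only [smul_eq_mul, h0, mul_zero, add_zero, div_mul_cancel₀ _ hb.ne'] at this
  rw [div_le_iff₀ ha]
  calc g a ≤ _ := this
    _ = _ := by ring

open ProbabilityTheory in
theorem erm_aux_cgf {Ω : Type*} [MeasurableSpace Ω] (μ : Measure Ω)
    [IsProbabilityMeasure μ] (Y : Ω → ℝ) (hm : AEMeasurable Y μ) (a b : ℝ)
    (hb : ∀ᵐ ω ∂μ, Y ω ∈ Set.Icc a b) (t : ℝ) :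
    HasDerivAt (cgf Y μ) (deriv (cgf Y μ) t) t ∧
    HasDerivAt (deriv (cgf Y μ)) (iteratedDeriv 2 (cgf Y μ) t) t ∧
    0 ≤ iteratedDeriv 2 (cgf Y μ) t ∧ iteratedDeriv 2 (cgf Y μ) t ≤ ((b - a) / 2) ^ 2 := by
  have hi (u : ℝ) : Integrable (fun ω ↦ Real.exp (u * Y ω)) μ := integrable_exp_mul_of_mem_Icc hm hb
  have hs : t ∈ interior (integrableExpSet Y μ) := by simp [hi, integrableExpSet]
  have han := analyticAt_cgf hs
  refine ⟨han.differentiableAt.hasDerivAt, ?_, ?_, ?_⟩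
  · rw [iteratedDeriv_succ, iteratedDeriv_one]
    exact han.deriv.differentiableAt.hasDerivAt
  · rw [← variance_tilted_mul hs]
    exact variance_nonneg _ _
  · rw [← variance_tilted_mul hs]
    have := isProbabilityMeasure_tilted (hi t)
    exact variance_le_sq_of_bounded ((tilted_absolutelyContinuous μ (t * Y ·)) hb)
      (hm.mono_ac (tilted_absolutelyContinuous μ (t * Y ·)))

/-- **Monotonicity and Lipschitz continuity of ERM in the risk level.**  If
`x_min ≤ X ≤ x_max` almost surely, then for all `0 < α₁ ≤ α₂`,
`0 ≤ ERM^{α₁}[X] − ERM^{α₂}[X] ≤ (α₂ − α₁)·(x_max − x_min)²/8`; in particular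
`α ↦ ERM^α[X]` is nonincreasing on `(0,∞)` and Lipschitz there with constant
`(x_max − x_min)²/8`. -/
theorem erm_antitone_lipschitz {Ω : Type*} [MeasurableSpace Ω] (μ : Measure Ω)
    [IsProbabilityMeasure μ] (X : Ω → ℝ) (hX : Measurable X) (xmin xmax : ℝ)
    (hlo : ∀ᵐ ω ∂μ, xmin ≤ X ω) (hhi : ∀ᵐ ω ∂μ, X ω ≤ xmax) :
    (∀ α₁ α₂ : ℝ, 0 < α₁ → α₁ ≤ α₂ →
      0 ≤ erm μ α₁ X - erm μ α₂ X ∧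
        erm μ α₁ X - erm μ α₂ X ≤ (α₂ - α₁) * (xmax - xmin) ^ 2 / 8) ∧
    AntitoneOn (fun α => erm μ α X) (Set.Ioi 0) ∧
    LipschitzOnWith (Real.toNNReal ((xmax - xmin) ^ 2 / 8)) (fun α => erm μ α X)
      (Set.Ioi 0) := by
  have hb : ∀ᵐ ω ∂μ, (-X) ω ∈ Set.Icc (-xmax) (-xmin) := by
    filter_upwards [hlo, hhi] with ω h1 h2
    exact ⟨neg_le_neg h2, neg_le_neg h1⟩
  have hK := erm_aux_cgf μ (-X) hX.neg.aemeasurable _ _ hb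
  have h0 : ProbabilityTheory.cgf (-X) μ 0 = 0 := by simp
  have herm : ∀ α, erm μ α X = - (ProbabilityTheory.cgf (-X) μ α / α) := by
    intro α
    simp only [erm, ProbabilityTheory.cgf, ProbabilityTheory.mgf, Pi.neg_apply, mul_neg, neg_mul]
    ring
  have main : ∀ α₁ α₂ : ℝ, 0 < α₁ → α₁ ≤ α₂ →
      0 ≤ erm μ α₁ X - erm μ α₂ X ∧
        erm μ α₁ X - erm μ α₂ X ≤ (α₂ - α₁) * (xmax - xmin) ^ 2 / 8 := by
    intro a b ha hab
    have hbp : 0 < b := ha.trans_le hab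
    rw [herm, herm]
    generalize ProbabilityTheory.cgf (-X) μ = K at hK h0
    have A := erm_aux_slope K _ _ (fun t => (hK t).1) (fun t => (hK t).2.1)
      (fun t => (hK t).2.2.1) h0 a b ha hab
    set c := ((-xmin - -xmax) / 2) ^ 2 with hc
    have B := erm_aux_slope (fun t => c / 2 * t ^ 2 - K t) (fun t => c * t - deriv K t)
      (fun t => c - iteratedDeriv 2 K t)
      (fun t => by
        have := ((hasDerivAt_pow 2 t).const_mul (c / 2)).sub (hK t).1
        convert! this using 1
        simp; ring)
      (fun t => by
        have := ((hasDerivAt_id t).const_mul c).sub (hK t).2.1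
        convert! this using 1
        simp)
      (fun t => sub_nonneg.2 (hK t).2.2.2) (by simp [h0]) a b ha hab
    have e : ∀ t : ℝ, 0 < t → (c / 2 * t ^ 2 - K t) / t = c / 2 * t - K t / t := by
      intro t ht
      field_simp
    simp only [e a ha, e b hbp] at B
    have hc' : (b - a) * (xmax - xmin) ^ 2 / 8 = c / 2 * b - c / 2 * a := by
      rw [hc]; ring
    rw [hc']
    constructor <;> linarith
  refine ⟨main, ?_, ?_⟩
  · intro a ha b _ hab
    have := (main a b ha hab).1
    simp only
    linarith
  · have hC : (0 : ℝ) ≤ (xmax - xmin) ^ 2 / 8 := by positivity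
    apply LipschitzOnWith.of_dist_le_mul
    intro a ha b hb'
    rw [Real.coe_toNNReal _ hC, Real.dist_eq, Real.dist_eq]
    rcases le_total a b with h | h
    · have := main a b ha h
      rw [abs_of_nonneg this.1, abs_of_nonpos (sub_nonpos.2 h)]
      linarith [this.2]
    · have := main b a hb' h
      rw [abs_sub_comm, abs_of_nonneg this.1, abs_of_nonneg (sub_nonneg.2 h)]
      linarith [this.2]
end

section
/- Let X be a bounded real-valued random variable on a probability space. Then ERM^α[X] → essInf X as α → ∞, where essInf X = sup{ c ∈ ℝ : P(X < c) = 0 } is the essential infimum of X. -/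
open MeasureTheory

/-- **ERM converges to the essential infimum as the risk level grows.**  For a bounded random
variable `X`, `ERM^α[X] → essInf X = sup{c : P(X < c) = 0}` as `α → ∞`. -/
theorem erm_tendsto_essInf {Ω : Type*} [MeasurableSpace Ω] (μ : Measure Ω)
    [IsProbabilityMeasure μ] (X : Ω → ℝ) (hX : Measurable X) (C : ℝ) (hC : ∀ ω, |X ω| ≤ C) :
    Filter.Tendsto (fun α => erm μ α X) Filter.atTop
      (nhds (sSup {c : ℝ | μ {ω | X ω < c} = 0})) := by
  have hint : ∀ α : ℝ, 0 < α → Integrable (fun ω => Real.exp (-α * X ω)) μ := by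
    intro α hα
    refine Integrable.of_bound (C := Real.exp (α * C)) ?_ ?_
    · exact (Real.measurable_exp.comp (hX.const_mul (-α))).aestronglyMeasurable
    · refine Filter.Eventually.of_forall fun ω => ?_
      rw [Real.norm_eq_abs, abs_of_pos (Real.exp_pos _), Real.exp_le_exp]
      have := (abs_le.1 (hC ω)).1
      nlinarith
  have hpos : ∀ α : ℝ, 0 < α → 0 < ∫ ω, Real.exp (-α * X ω) ∂μ := fun α hα =>
    integral_exp_pos (hint α hα)
  have hne : {c : ℝ | μ {ω | X ω < c} = 0}.Nonempty := by
    refine ⟨-C, ?_⟩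
    have : {ω | X ω < -C} = ∅ := by
      ext ω
      simpa using (abs_le.1 (hC ω)).1
    simp [this]
  have hbdd : BddAbove {c : ℝ | μ {ω | X ω < c} = 0} := by
    refine ⟨C, fun c hc => ?_⟩
    by_contra hlt
    push Not at hlt
    have : {ω | X ω < c} = Set.univ := by
      ext ω
      simpa using lt_of_le_of_lt (abs_le.1 (hC ω)).2 hlt
    simp [this] at hc
  refine tendsto_order.2 ⟨fun a ha => ?_, fun b hb => ?_⟩
  · obtain ⟨c, hc, hac⟩ := exists_lt_of_lt_csSup hne ha
    filter_upwards [Filter.eventually_gt_atTop (0 : ℝ)] with α hα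
    refine lt_of_lt_of_le hac ?_
    have hle : ∫ ω, Real.exp (-α * X ω) ∂μ ≤ Real.exp (-α * c) := by
      have h1 : ∫ ω, Real.exp (-α * X ω) ∂μ ≤ ∫ _ω, Real.exp (-α * c) ∂μ := by
        refine integral_mono_ae (hint α hα) (integrable_const _) ?_
        have hae : ∀ᵐ ω ∂μ, ¬ X ω < c := by
          rw [ae_iff]
          simpa using hc
        filter_upwards [hae] with ω hω
        rw [Real.exp_le_exp]
        push Not at hω
        nlinarith
      simpa using h1
    have hlog := Real.log_le_log (hpos α hα) hle
    rw [Real.log_exp] at hlog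
    unfold erm
    rw [show -(1 / α) * Real.log (∫ ω, Real.exp (-α * X ω) ∂μ)
      = (-Real.log (∫ ω, Real.exp (-α * X ω) ∂μ)) / α by ring, le_div_iff₀ hα]
    linarith
  · obtain ⟨c, hmc, hcb⟩ := exists_between hb
    have hcS : μ {ω | X ω < c} ≠ 0 := fun h => absurd (le_csSup hbdd h) (not_le.2 hmc)
    have hms : MeasurableSet {ω | X ω < c} := measurableSet_lt hX measurable_const
    have hp : 0 < μ.real {ω | X ω < c} :=
      ENNReal.toReal_pos hcS (measure_ne_top _ _)
    have hlim : Filter.Tendsto (fun α : ℝ => c - Real.log (μ.real {ω | X ω < c}) / α)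
        Filter.atTop (nhds c) := by
      simpa using (tendsto_const_nhds (x := c)).sub
        (Filter.Tendsto.const_div_atTop (Filter.tendsto_id (α := ℝ))
          (Real.log (μ.real {ω | X ω < c})))
    filter_upwards [Filter.eventually_gt_atTop (0 : ℝ), hlim.eventually_lt_const hcb]
      with α hα hαb
    refine lt_of_le_of_lt ?_ hαb
    have hge : μ.real {ω | X ω < c} * Real.exp (-α * c) ≤ ∫ ω, Real.exp (-α * X ω) ∂μ := by
      have h1 : ∫ ω, ({ω | X ω < c}.indicator (fun _ => Real.exp (-α * c))) ω ∂μ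
          ≤ ∫ ω, Real.exp (-α * X ω) ∂μ := by
        refine integral_mono ((integrable_const _).indicator hms) (hint α hα) ?_
        intro ω
        by_cases h : X ω < c
        · rw [Set.indicator_of_mem (by exact h)]
          refine Real.exp_le_exp.2 ?_
          nlinarith
        · rw [Set.indicator_of_notMem (by exact h)]
          exact (Real.exp_pos _).le
      rwa [integral_indicator_const _ hms, smul_eq_mul] at h1
    have hlog := Real.log_le_log (mul_pos hp (Real.exp_pos _)) hge
    rw [Real.log_mul hp.ne' (Real.exp_pos _).ne', Real.log_exp] at hlog
    unfold erm
    rw [show -(1 / α) * Real.log (∫ ω, Real.exp (-α * X ω) ∂μ)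
      = (-Real.log (∫ ω, Real.exp (-α * X ω) ∂μ)) / α by ring, div_le_iff₀ hα, sub_mul,
      div_mul_cancel₀ _ hα.ne']
    linarith
end

section
/- Let X be a bounded real-valued random variable on a probability space. Then EVaR^β[X] → essInf X as β → 1⁻, where essInf X = sup{ c ∈ ℝ : P(X < c) = 0 }. -/
open MeasureTheory

lemma integrable_aux {Ω : Type*} [MeasurableSpace Ω] (μ : Measure Ω)
    [IsProbabilityMeasure μ] (X : Ω → ℝ) (hX : Measurable X) (C : ℝ) (hC : ∀ ω, |X ω| ≤ C)
    (α : ℝ) : Integrable (fun ω => Real.exp (-α * X ω)) μ := by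
  refine Integrable.of_bound (C := Real.exp (|α| * C)) ?_ ?_
  · exact (Real.measurable_exp.comp (hX.const_mul (-α))).aestronglyMeasurable
  · refine Filter.Eventually.of_forall fun ω => ?_
    rw [Real.norm_eq_abs, Real.abs_exp]
    apply Real.exp_le_exp.mpr
    calc -α * X ω ≤ |-α * X ω| := le_abs_self _
      _ = |α| * |X ω| := by rw [abs_mul, abs_neg]
      _ ≤ |α| * C := mul_le_mul_of_nonneg_left (hC ω) (abs_nonneg _)

/-- Upper bound on the entropic risk measure through a lower tail probability. -/
lemma erm_le_aux {Ω : Type*} [MeasurableSpace Ω] (μ : Measure Ω)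
    [IsProbabilityMeasure μ] (X : Ω → ℝ) (hX : Measurable X) (C : ℝ) (hC : ∀ ω, |X ω| ≤ C)
    (α : ℝ) (hα : 0 < α) (c : ℝ) (hp : 0 < μ.real {ω | X ω < c}) :
    erm μ α X ≤ c - Real.log (μ.real {ω | X ω < c}) / α := by
  have hm : MeasurableSet {ω | X ω < c} := measurableSet_lt hX measurable_const
  have hi := integrable_aux μ X hX C hC α
  have h1 : μ.real {ω | X ω < c} * Real.exp (-α * c) ≤ ∫ ω, Real.exp (-α * X ω) ∂μ := by
    calc μ.real {ω | X ω < c} * Real.exp (-α * c)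
        = ∫ ω in {ω | X ω < c}, Real.exp (-α * c) ∂μ := by
          rw [setIntegral_const, smul_eq_mul]
      _ ≤ ∫ ω in {ω | X ω < c}, Real.exp (-α * X ω) ∂μ := by
          refine setIntegral_mono_on (integrable_const _).integrableOn hi.integrableOn hm ?_
          intro ω hω
          have hω' : X ω < c := hω
          apply Real.exp_le_exp.mpr
          nlinarith
      _ ≤ ∫ ω, Real.exp (-α * X ω) ∂μ :=
          setIntegral_le_integral hi (Filter.Eventually.of_forall fun ω => (Real.exp_pos _).le)
  have h2 := Real.log_le_log (mul_pos hp (Real.exp_pos _)) h1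
  rw [Real.log_mul hp.ne' (Real.exp_pos _).ne', Real.log_exp] at h2
  unfold erm
  have h3 := mul_le_mul_of_nonneg_left h2 (one_div_pos.mpr hα).le
  have h4 : 1 / α * (Real.log (μ.real {ω | X ω < c}) + -α * c)
      = Real.log (μ.real {ω | X ω < c}) / α - c := by
    field_simp
    ring
  linarith

/-- Lower bound on the entropic risk measure by an almost sure lower bound. -/
lemma le_erm_aux {Ω : Type*} [MeasurableSpace Ω] (μ : Measure Ω)
    [IsProbabilityMeasure μ] (X : Ω → ℝ) (hX : Measurable X) (C : ℝ) (hC : ∀ ω, |X ω| ≤ C)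
    (α : ℝ) (hα : 0 < α) (c : ℝ) (hc : μ {ω | X ω < c} = 0) :
    c ≤ erm μ α X := by
  have hi := integrable_aux μ X hX C hC α
  have hpos : 0 < ∫ ω, Real.exp (-α * X ω) ∂μ := integral_exp_pos hi
  have h1 : ∫ ω, Real.exp (-α * X ω) ∂μ ≤ Real.exp (-α * c) := by
    have hae : ∀ᵐ ω ∂μ, Real.exp (-α * X ω) ≤ Real.exp (-α * c) := by
      have h0 : ∀ᵐ ω ∂μ, ¬ X ω < c := by
        rw [ae_iff]
        simpa using hc
      filter_upwards [h0] with ω hω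
      apply Real.exp_le_exp.mpr
      nlinarith [not_lt.mp hω]
    have := integral_mono_ae hi (integrable_const _) hae
    simpa using this
  have h2 := Real.log_le_log hpos h1
  rw [Real.log_exp] at h2
  unfold erm
  have h3 := mul_le_mul_of_nonneg_left h2 (one_div_pos.mpr hα).le
  have h4 : 1 / α * (-α * c) = - c := by
    field_simp
  linarith

/-- **EVaR converges to the essential infimum as the confidence level tends to one.**  For a
bounded random variable `X`, `EVaR^β[X] → essInf X = sup{c : P(X < c) = 0}` as `β → 1⁻`. -/
theorem evar_tendsto_essInf {Ω : Type*} [MeasurableSpace Ω] (μ : Measure Ω)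
    [IsProbabilityMeasure μ] (X : Ω → ℝ) (hX : Measurable X) (C : ℝ) (hC : ∀ ω, |X ω| ≤ C) :
    Filter.Tendsto (fun β => evar μ β X) (nhdsWithin 1 (Set.Iio 1))
      (nhds (sSup {c : ℝ | μ {ω | X ω < c} = 0})) := by
  have hup : ∀ c, C < c → μ.real {ω | X ω < c} = 1 := by
    intro c hc
    have : {ω | X ω < c} = Set.univ := by
      ext ω
      simp only [Set.mem_setOf_eq, Set.mem_univ, iff_true]
      exact lt_of_le_of_lt ((le_abs_self _).trans (hC ω)) hc
    rw [this]
    simp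
  have hne : {c : ℝ | μ {ω | X ω < c} = 0}.Nonempty := by
    refine ⟨-C, ?_⟩
    have : {ω | X ω < -C} = ∅ := by
      ext ω
      simp only [Set.mem_setOf_eq, Set.mem_empty_iff_false, iff_false, not_lt]
      exact (abs_le.mp (hC ω)).1
    simp [this]
  have hbdd : BddAbove {c : ℝ | μ {ω | X ω < c} = 0} := by
    refine ⟨C, fun c hc => ?_⟩
    by_contra h
    have h1 := hup c (not_le.mp h)
    have hc' : μ {ω | X ω < c} = 0 := hc
    simp [Measure.real, hc'] at h1
  have hev : ∀ ε : ℝ, 0 < ε → ∀ᶠ β in nhdsWithin (1 : ℝ) (Set.Iio 1), 1 - ε < β ∧ β < 1 := by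
    intro ε hε
    filter_upwards [Ioo_mem_nhdsLT (show 1 - ε < 1 by linarith)] with β hβ
    exact hβ
  refine tendsto_order.2 ⟨fun c hc => ?_, fun c hc => ?_⟩
  · obtain ⟨d, hd, hcd⟩ := exists_lt_of_lt_csSup hne hc
    filter_upwards [hev 1 one_pos] with β hβ
    have hl : Real.log (1 - β) < 0 := Real.log_neg (by linarith [hβ.2]) (by linarith [hβ.1])
    have hB : BddAbove {y | ∃ α > (0 : ℝ), y = erm μ α X + Real.log (1 - β) / α} := by
      refine ⟨C + 1, ?_⟩
      rintro y ⟨α, hα, rfl⟩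
      have h1 := hup (C + 1) (by linarith)
      have h2 := erm_le_aux μ X hX C hC α hα (C + 1) (by rw [h1]; exact one_pos)
      rw [h1, Real.log_one, zero_div, sub_zero] at h2
      have := div_neg_of_neg_of_pos hl hα
      linarith
    have hdc : 0 < d - c := by linarith
    have hα : 0 < 2 * -Real.log (1 - β) / (d - c) := div_pos (by linarith) hdc
    have h3 := le_csSup hB ⟨_, hα, rfl⟩
    have h4 := le_erm_aux μ X hX C hC _ hα d hd
    have h5 : Real.log (1 - β) / (2 * -Real.log (1 - β) / (d - c)) = -(d - c) / 2 := by
      have := hl.ne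
      field_simp
    rw [h5] at h3
    unfold evar
    linarith
  · obtain ⟨d, hd, hdc⟩ := exists_between hc
    have hp : 0 < μ.real {ω | X ω < d} := by
      refine ENNReal.toReal_pos (fun h => ?_) (measure_ne_top _ _)
      exact absurd (le_csSup hbdd h) (not_le.mpr hd)
    filter_upwards [hev _ hp] with β hβ
    refine lt_of_le_of_lt ?_ hdc
    refine csSup_le ⟨_, 1, one_pos, rfl⟩ ?_
    rintro y ⟨α, hα, rfl⟩
    have h2 := erm_le_aux μ X hX C hC α hα d hp
    have h3 : Real.log (1 - β) ≤ Real.log (μ.real {ω | X ω < d}) :=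
      Real.log_le_log (by linarith [hβ.2]) (by linarith [hβ.1])
    have h4 := div_le_div_of_nonneg_right h3 hα.le
    linarith
end
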